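/- For a generic ρ ∈ Hom_σ(Γ, Sym(ℤ)), for every x ∈ ℤ the stabilizer Stab_Γ(x) = {γ ∈ Γ : ρ(γ)(x) = x} is a boomerang subgroup of Γ. -/

import Mathlib

open Filter Set

/-- Pointwise-convergence topology on `Sym(ℤ)` (with `ℤ` discrete). -/
instance permIntTopology : TopologicalSpace (Equiv.Perm ℤ) :=
  TopologicalSpace.induced (fun g : Equiv.Perm ℤ => (g : ℤ → ℤ)) inferInstance

/-- The shift `σ : n ↦ n + 1`. -/
def shiftPerm : Equiv.Perm ℤ := Equiv.addRight 1

/-- Pointwise-convergence topology on the space of homomorphisms `Γ → Sym(ℤ)`. -/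
instance homTopology {ι : Type*} : TopologicalSpace (FreeGroup ι →* Equiv.Perm ℤ) :=
  TopologicalSpace.induced (fun ρ => (ρ : FreeGroup ι → Equiv.Perm ℤ)) inferInstance

/-- `Hom_σ(Γ, Sym(ℤ))`: homomorphisms sending the distinguished free generator `a₀` to the
shift `σ`, with the subspace (= pointwise convergence) topology. -/
abbrev HomSigma {ι : Type*} (a₀ : ι) : Type _ :=
  {ρ : FreeGroup ι →* Equiv.Perm ℤ // ρ (FreeGroup.of a₀) = shiftPerm}

/-- The stabilizer `Stab_Γ(x) = {γ ∈ Γ : ρ(γ)(x) = x}` as a subgroup of `Γ`. -/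
noncomputable def stabSubgroup {ι : Type*} (ρ : FreeGroup ι →* Equiv.Perm ℤ) (x : ℤ) :
    Subgroup (FreeGroup ι) :=
  (MulAction.stabilizer (Equiv.Perm ℤ) x).comap ρ

/-- The conjugate subgroup `g Δ g⁻¹`. -/
def conjSubgroup {G : Type*} [Group G] (g : G) (Δ : Subgroup G) : Subgroup G :=
  Δ.map (MulAut.conj g).toMonoidHom

/-- `Δ` is a boomerang subgroup of `G`: for every `γ ∈ G` there is a sequence `n_j → ∞`
with `γ^{n_j} Δ γ^{-n_j} → Δ` in the Chabauty topology, i.e. for every finite `F ⊆ G`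
one has `γ^{n_j} Δ γ^{-n_j} ∩ F = Δ ∩ F` for all sufficiently large `j`. -/
def IsBoomerang {G : Type*} [Group G] (Δ : Subgroup G) : Prop :=
  ∀ γ : G, ∃ n : ℕ → ℕ, Tendsto n atTop atTop ∧
    ∀ F : Finset G, ∀ᶠ j in atTop, ∀ δ ∈ F, (δ ∈ conjSubgroup (γ ^ n j) Δ ↔ δ ∈ Δ)

/-- A permutation of the window `[-k, k]` extends to a `(2k+1)`-periodic permutation of `ℤ`. -/
lemma exists_periodic_extension (k : ℕ)
    (e : Equiv.Perm (Finset.Icc (-k : ℤ) k)) :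
    ∃ h : Equiv.Perm ℤ, (∀ p, h (p + (2 * k + 1)) = h p + (2 * k + 1)) ∧
      ∀ p : Finset.Icc (-k : ℤ) k, h p = e p := by
  have hn : (0 : ℤ) < 2 * k + 1 := by positivity
  let r : ℤ → Finset.Icc (-k : ℤ) k := fun p => ⟨(p + k) % (2 * k + 1) - k, by
    have h₁ := Int.emod_nonneg (p + k) hn.ne'
    have h₂ := Int.emod_lt_of_pos (p + k) hn
    rw [Finset.mem_Icc]
    omega⟩
  let q : ℤ → ℤ := fun p => (p + k) / (2 * k + 1)
  have hdecomp (p : ℤ) : (2 * k + 1) * q p + r p = p := by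
    have := Int.mul_ediv_add_emod (p + k) (2 * k + 1)
    simp only [q, r]
    linarith
  have hunique (m : ℤ) (b : Finset.Icc (-k : ℤ) k) :
      q ((2 * k + 1) * m + b) = m ∧ r ((2 * k + 1) * m + b) = b := by
    have hb := Finset.mem_Icc.1 b.2
    have h₀ : (2 * k + 1) * m + b + k = (b + k : ℤ) + (2 * k + 1) * m := by ring
    constructor
    · simp only [q]
      rw [h₀, Int.add_mul_ediv_left _ _ hn.ne',
        Int.ediv_eq_zero_of_lt (by linarith) (by linarith), zero_add]
    · apply Subtype.ext
      simp only [r]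
      rw [h₀, Int.add_mul_emod_self_left,
        Int.emod_eq_of_lt (by linarith) (by linarith), add_sub_cancel_right]
  refine ⟨⟨fun p => (2 * k + 1) * q p + e (r p), fun p => (2 * k + 1) * q p + e.symm (r p),
    fun p => ?_, fun p => ?_⟩, fun p => ?_, fun p => ?_⟩
  · simp only [(hunique (q p) (e (r p))).1, (hunique (q p) (e (r p))).2, Equiv.symm_apply_apply,
      hdecomp]
  · simp only [(hunique (q p) (e.symm (r p))).1, (hunique (q p) (e.symm (r p))).2,
      Equiv.apply_symm_apply, hdecomp]
  · have h₀ : p + (2 * k + 1) = (2 * k + 1) * (q p + 1) + r p := by linarith [hdecomp p]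
    simp only [Equiv.coe_fn_mk]
    rw [h₀, (hunique _ _).1, (hunique _ _).2]
    ring
  · have h₀ := hunique 0 p
    simp only [mul_zero, zero_add] at h₀
    simp only [Equiv.coe_fn_mk, h₀, mul_zero, zero_add]

/-- Every permutation of `ℤ` agrees with a `(2k+1)`-periodic one wherever it stays in `[-k, k]`. -/
lemma exists_periodic_approximation (g : Equiv.Perm ℤ) (k : ℕ) :
    ∃ h : Equiv.Perm ℤ, (∀ p, h (p + (2 * k + 1)) = h p + (2 * k + 1)) ∧
      ∀ p, p ∈ Finset.Icc (-k : ℤ) k → g p ∈ Finset.Icc (-k : ℤ) k → h p = g p := by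
  classical
  obtain ⟨e, he⟩ := Finset.exists_equiv_extend_of_card_eq
    (α := Finset.Icc (-k : ℤ) k) (t := Finset.Icc (-k : ℤ) k) (Fintype.card_coe _)
    (s := Finset.univ.filter fun p => g p ∈ Finset.Icc (-k : ℤ) k) (f := fun p => g p)
    (by
      intro y hy
      obtain ⟨p, hp, rfl⟩ := Finset.mem_image.1 hy
      exact (Finset.mem_filter.1 hp).2)
    (fun p _ p' _ h => Subtype.ext (g.injective h))
  obtain ⟨h, hper, hext⟩ := exists_periodic_extension k e
  refine ⟨h, hper, fun p hp hgp => ?_⟩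
  rw [hext ⟨p, hp⟩]
  exact he _ (Finset.mem_filter.2 ⟨Finset.mem_univ _, hgp⟩)

/-- If generators of `ρ` are eventually approximated pointwise, so are all elements. -/
lemma eventually_apply_eq_of_generators {ι : Type*} (ρ : FreeGroup ι →* Equiv.Perm ℤ)
    (ρ' : ℕ → FreeGroup ι →* Equiv.Perm ℤ)
    (h : ∀ i p, ∀ᶠ k in atTop, ρ' k (FreeGroup.of i) p = ρ (FreeGroup.of i) p)
    (w : FreeGroup ι) : ∀ p, ∀ᶠ k in atTop, ρ' k w p = ρ w p := by
  induction w using FreeGroup.induction_on with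
  | C1 => simp
  | of i => exact h i
  | inv_of i _ =>
    intro p
    filter_upwards [h i ((ρ (FreeGroup.of i))⁻¹ p)] with k hk
    rw [map_inv, map_inv, Equiv.Perm.inv_eq_iff_eq, hk, ← Equiv.Perm.mul_apply,
      mul_inv_cancel, Equiv.Perm.one_apply]
  | mul u v hu hv =>
    intro p
    filter_upwards [hv p, hu (ρ v p)] with k hk hk'
    simp only [map_mul, Equiv.Perm.mul_apply, hk, hk']

/-- The homomorphisms commuting with some nontrivial translation are dense in `Hom_σ`. -/
lemma dense_setOf_periodic {ι : Type*} (a₀ : ι) :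
    Dense {ρ : HomSigma a₀ | ∃ k : ℕ, ∀ w p,
      ρ.1 w (p + (2 * k + 1)) = ρ.1 w p + (2 * k + 1)} := by
  classical
  intro ρ
  choose h hper happ using exists_periodic_approximation
  let ρ' (k : ℕ) : FreeGroup ι →* Equiv.Perm ℤ :=
    FreeGroup.lift fun i => if i = a₀ then shiftPerm else h (ρ.1 (FreeGroup.of i)) k
  have hσ (k : ℕ) : ρ' k (FreeGroup.of a₀) = shiftPerm := by simp [ρ']
  refine mem_closure_of_tendsto (f := fun k => (⟨ρ' k, hσ k⟩ : HomSigma a₀)) (b := atTop) ?_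
    (Eventually.of_forall fun k => ⟨k, fun w => ?_⟩)
  · simp only [nhds_induced, tendsto_comap_iff, tendsto_pi_nhds,
      nhds_discrete, tendsto_pure, Function.comp_def]
    refine eventually_apply_eq_of_generators ρ.1 ρ' fun i p => ?_
    by_cases hi : i = a₀
    · subst hi
      exact Eventually.of_forall fun k => by rw [hσ, ρ.2]
    · filter_upwards [eventually_ge_atTop p.natAbs,
        eventually_ge_atTop (ρ.1 (FreeGroup.of i) p).natAbs] with k h₁ h₂
      simp only [ρ', FreeGroup.lift_apply_of, if_neg hi]
      exact happ _ _ _ (Finset.mem_Icc.2 (by omega)) (Finset.mem_Icc.2 (by omega))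
  · change ∀ p, ρ' k w (p + (2 * k + 1)) = ρ' k w p + (2 * k + 1)
    have hgen (i : ι) (p : ℤ) :
        ρ' k (FreeGroup.of i) (p + (2 * k + 1)) = ρ' k (FreeGroup.of i) p + (2 * k + 1) := by
      by_cases hi : i = a₀
      · simp only [hi, hσ, shiftPerm, Equiv.coe_addRight]
        ring
      · simp only [ρ', FreeGroup.lift_apply_of, if_neg hi]
        exact hper _ _ _
    induction w using FreeGroup.induction_on with
    | C1 => simp
    | of i => exact hgen i
    | inv_of i _ =>
      intro p
      rw [map_inv, Equiv.Perm.inv_eq_iff_eq, hgen, ← Equiv.Perm.mul_apply,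
      mul_inv_cancel, Equiv.Perm.one_apply]
    | mul u v hu hv =>
      intro p
      simp only [map_mul, Equiv.Perm.mul_apply, hv, hu]

/-- For an action commuting with a nontrivial translation, each `γ`-orbit returns infinitely often
to points obtained from the base point by translations commuting with the action. -/
lemma exists_pow_stabilizer_eq {G : Type*} [Group G] (ρ : G →* Equiv.Perm ℤ) (k : ℕ)
    (hρ : ∀ w p, ρ w (p + (2 * k + 1)) = ρ w p + (2 * k + 1)) (γ : G) (x : ℤ) (N : ℕ) :
    ∃ n ≥ N, ∀ δ, ρ δ (ρ (γ ^ n) x) = ρ (γ ^ n) x ↔ ρ δ x = x := by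
  have hn : (0 : ℤ) < 2 * k + 1 := by positivity
  have hmul (w : G) (m : ℤ) : ∀ p, ρ w (p + m * (2 * k + 1)) = ρ w p + m * (2 * k + 1) := by
    induction m using Int.induction_on with
    | zero => simp
    | succ m ih =>
      intro p
      rw [add_mul, one_mul, ← add_assoc, hρ, ih, add_assoc]
    | pred m ih =>
      intro p
      have := hρ w (p + (-m - 1) * (2 * k + 1))
      rw [show p + (-m - 1) * (2 * k + 1) + (2 * k + 1) = p + -m * (2 * k + 1) by ring, ih] at this
      linarith
  obtain ⟨s, t, hst, h⟩ : ∃ s t : ℕ, s < t ∧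
      ρ (γ ^ (s * (N + 1))) x % (2 * k + 1) = ρ (γ ^ (t * (N + 1))) x % (2 * k + 1) := by
    obtain ⟨s, -, t, -, hne, h⟩ := Set.infinite_univ.exists_ne_map_eq_of_mapsTo
      (f := fun s : ℕ => ρ (γ ^ (s * (N + 1))) x % (2 * k + 1))
      (t := Set.Ico (0 : ℤ) (2 * k + 1))
      (fun s _ => ⟨Int.emod_nonneg _ hn.ne', Int.emod_lt_of_pos _ hn⟩) (Set.finite_Ico _ _)
    rcases hne.lt_or_gt with hlt | hlt
    · exact ⟨s, t, hlt, h⟩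
    · exact ⟨t, s, hlt, h.symm⟩
  obtain ⟨m, hm⟩ := Int.ModEq.dvd h
  have hsplit : γ ^ (t * (N + 1)) = γ ^ (s * (N + 1)) * γ ^ ((t - s) * (N + 1)) := by
    rw [← pow_add, ← add_mul, Nat.add_sub_cancel' hst.le]
  have hreturn : ρ (γ ^ ((t - s) * (N + 1))) x = x + m * (2 * k + 1) := by
    apply (ρ (γ ^ (s * (N + 1)))).injective
    rw [← Equiv.Perm.mul_apply, ← map_mul, ← hsplit, hmul]
    linarith
  refine ⟨(t - s) * (N + 1), ?_, fun δ => ?_⟩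
  · have : 1 ≤ t - s := by omega
    nlinarith
  · rw [hreturn, hmul]
    exact add_left_inj _

lemma mem_conjSubgroup_stabSubgroup {ι : Type*} (ρ : FreeGroup ι →* Equiv.Perm ℤ) (x : ℤ)
    (g δ : FreeGroup ι) :
    δ ∈ conjSubgroup g (stabSubgroup ρ x) ↔ ρ δ (ρ g x) = ρ g x := by
  rw [conjSubgroup, Subgroup.mem_map_equiv, stabSubgroup, Subgroup.mem_comap,
    MulAction.mem_stabilizer_iff, MulAut.conj_symm_apply, Equiv.Perm.smul_def]
  simp only [map_mul, map_inv, Equiv.Perm.mul_apply, Equiv.Perm.inv_eq_iff_eq]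

/-- It suffices to find, for each finite set, arbitrarily large good exponents. -/
lemma isBoomerang_of_forall_exists {G : Type*} [Group G] [Countable G] {Δ : Subgroup G}
    (h : ∀ (γ : G) (F : Finset G) (N : ℕ), ∃ n ≥ N,
      ∀ δ ∈ F, (δ ∈ conjSubgroup (γ ^ n) Δ ↔ δ ∈ Δ)) : IsBoomerang Δ := by
  classical
  intro γ
  obtain ⟨f, hf⟩ := exists_surjective_nat G
  choose n hn hF using fun j : ℕ => h γ ((Finset.range j).image f) j
  refine ⟨n, tendsto_atTop_mono hn tendsto_id, fun F => ?_⟩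
  rw [Filter.eventually_all_finset]
  intro δ _
  obtain ⟨i, rfl⟩ := hf δ
  filter_upwards [eventually_gt_atTop i] with j hj
  exact hF j _ (Finset.mem_image_of_mem f (Finset.mem_range.2 hj))

lemma continuous_homSigma_apply {ι : Type*} (a₀ : ι) (w : FreeGroup ι) (p : ℤ) :
    Continuous fun ρ : HomSigma a₀ => ρ.1 w p :=
  (continuous_apply p).comp <| continuous_induced_dom.comp <|
    (continuous_apply w).comp <| continuous_induced_dom.comp continuous_subtype_val

lemma isClopen_setOf_apply_eq {ι : Type*} (a₀ : ι) (w w' : FreeGroup ι) (x : ℤ) :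
    IsClopen {ρ : HomSigma a₀ | ρ.1 w x = ρ.1 w' x} :=
  (isClopen_discrete {q : ℤ × ℤ | q.1 = q.2}).preimage
    ((continuous_homSigma_apply a₀ w x).prodMk (continuous_homSigma_apply a₀ w' x))

lemma isOpen_setOf_return {ι : Type*} (a₀ : ι) (γ : FreeGroup ι) (F : Finset (FreeGroup ι))
    (N : ℕ) (x : ℤ) :
    IsOpen {ρ : HomSigma a₀ | ∃ n ≥ N, ∀ δ ∈ F,
      (ρ.1 δ (ρ.1 (γ ^ n) x) = ρ.1 (γ ^ n) x ↔ ρ.1 δ x = x)} := by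
  simp only [Set.ofPred_exists, Set.ofPred_and, Set.ofPred_forall]
  refine isOpen_iUnion fun n => isOpen_const.inter <|
    isOpen_biInter_finset fun δ _ => ?_
  have h₁ := isClopen_setOf_apply_eq a₀ (δ * γ ^ n) (γ ^ n) x
  have h₂ := isClopen_setOf_apply_eq a₀ δ 1 x
  simp only [map_mul, map_one, Equiv.Perm.mul_apply, Equiv.Perm.one_apply] at h₁ h₂
  convert (h₁.himp h₂).inter (h₂.himp h₁) |>.isOpen using 1
  ext ρ
  simp only [Set.mem_ofPred_eq, Set.mem_inter_iff, Set.mem_himp_iff]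
  exact iff_iff_implies_and_implies

/-- **Generic stabilizers are boomerang subgroups.**  For a generic
`ρ ∈ Hom_σ(Γ, Sym(ℤ))` (`Γ` free with basis `(a₀, b₁, b₂, …)`), every point stabilizer
`Stab_Γ(x)`, `x ∈ ℤ`, is a boomerang subgroup of `Γ`. -/
theorem generic_stabilizers_boomerang {ι : Type*} [Countable ι] [Nontrivial ι] (a₀ : ι) :
    {ρ : HomSigma a₀ | ∀ x : ℤ, IsBoomerang (stabSubgroup ρ.1 x)}
      ∈ residual (HomSigma a₀) := by
  have hres : ∀ (γ : FreeGroup ι) (F : Finset (FreeGroup ι)) (N : ℕ) (x : ℤ),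
      ∀ᶠ ρ : HomSigma a₀ in residual (HomSigma a₀), ∃ n ≥ N, ∀ δ ∈ F,
        (ρ.1 δ (ρ.1 (γ ^ n) x) = ρ.1 (γ ^ n) x ↔ ρ.1 δ x = x) := by
    intro γ F N x
    refine residual_of_dense_open (isOpen_setOf_return a₀ γ F N x)
      ((dense_setOf_periodic a₀).mono ?_)
    rintro ρ ⟨k, hk⟩
    obtain ⟨n, hn, h⟩ := exists_pow_stabilizer_eq ρ.1 k hk γ x N
    exact ⟨n, hn, fun δ _ => h δ⟩
  have : Countable (FreeGroup ι) := Quot.mk_surjective.countable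
  simp only [← eventually_countable_forall] at hres
  filter_upwards [hres] with ρ hρ x
  refine isBoomerang_of_forall_exists fun γ F N => ?_
  obtain ⟨n, hn, h⟩ := hρ γ F N x
  refine ⟨n, hn, fun δ hδ => ?_⟩
  rw [mem_conjSubgroup_stabSubgroup, h δ hδ]
  rfl
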